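/- Theorem 1 (second derivatives of the first component): let D ⊆ ℝ² be open and let U₁, U₂, U₃, U₄ : D → ℝ be twice continuously differentiable and satisfy the Cauchy–Riemann-type system (CR) on D; write W = U₁ (so W is the first component of a monogenic function Φ* and Φ = Φ*'' has first component ∂²U₁/∂x² and fourth component ∂²U₄/∂x²). Then at every point of D: ∂²W/∂x² = ∂²U₁/∂x² and ∂²W/∂y² = ∂²U₁/∂x² − 2·∂²U₄/∂x². -/

import Mathlib

/- Theorem 1 of the paper: second derivatives of the first component W = U₁ of a
   monogenic function Φ* in terms of the components of Φ = Φ*''.  Since Φ*' = ∂Φ*/∂x,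
   the first and fourth components of Φ are ∂²U₁/∂x² and ∂²U₄/∂x². -/

noncomputable section

/-- The partial derivative in `x` of a function `ℝ² → ℝ`. -/
def pdx (f : ℝ × ℝ → ℝ) : ℝ × ℝ → ℝ := fun p => fderiv ℝ f p (1, 0)

/-- The partial derivative in `y` of a function `ℝ² → ℝ`. -/
def pdy (f : ℝ × ℝ → ℝ) : ℝ × ℝ → ℝ := fun p => fderiv ℝ f p (0, 1)

/-- The Cauchy–Riemann-type system for the components `U₁, U₂, U₃, U₄`. -/
def CRsys (U₁ U₂ U₃ U₄ : ℝ × ℝ → ℝ) (p : ℝ × ℝ) : Prop :=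
  pdy U₁ p = pdx U₃ p ∧
  pdy U₂ p = pdx U₄ p ∧
  pdy U₃ p = pdx U₁ p - 2 * pdx U₄ p ∧
  pdy U₄ p = pdx U₂ p + 2 * pdx U₃ p

theorem pdx_congr_of_eventuallyEq {f g : ℝ × ℝ → ℝ} {p : ℝ × ℝ} (h : f =ᶠ[nhds p] g) :
    pdx f p = pdx g p := by
  simp only [pdx, h.fderiv_eq]

theorem pdy_congr_of_eventuallyEq {f g : ℝ × ℝ → ℝ} {p : ℝ × ℝ} (h : f =ᶠ[nhds p] g) :
    pdy f p = pdy g p := by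
  simp only [pdy, h.fderiv_eq]

theorem differentiableAt_fderiv_of_contDiffAt_two {f : ℝ × ℝ → ℝ} {p : ℝ × ℝ}
    (h : ContDiffAt ℝ 2 f p) : DifferentiableAt ℝ (fderiv ℝ f) p :=
  (h.fderiv_right (m := 1) (by norm_num)).differentiableAt (by norm_num)

theorem differentiableAt_pdx {f : ℝ × ℝ → ℝ} {p : ℝ × ℝ} (h : ContDiffAt ℝ 2 f p) :
    DifferentiableAt ℝ (pdx f) p :=
  (differentiableAt_fderiv_of_contDiffAt_two h).clm_apply (differentiableAt_const _)

theorem pdy_pdx_comm {f : ℝ × ℝ → ℝ} {p : ℝ × ℝ} (h : ContDiffAt ℝ 2 f p) :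
    pdy (pdx f) p = pdx (pdy f) p := by
  have key (v w : ℝ × ℝ) :
      fderiv ℝ (fun q => fderiv ℝ f q v) p w = fderiv ℝ (fderiv ℝ f) p w v := by
    rw [fderiv_clm_apply (differentiableAt_fderiv_of_contDiffAt_two h)
      (differentiableAt_const _)]
    simp
  change fderiv ℝ (fun q => fderiv ℝ f q (1, 0)) p (0, 1)
    = fderiv ℝ (fun q => fderiv ℝ f q (0, 1)) p (1, 0)
  rw [key, key]
  exact (h.isSymmSndFDerivAt (by simp)).eq _ _

/-- Theorem 1: if `U₁, U₂, U₃, U₄` are twice continuously differentiable on an open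
set `D` and satisfy (CR) there, and `W = U₁`, then at every point of `D`:
`∂²W/∂x² = ∂²U₁/∂x²` and `∂²W/∂y² = ∂²U₁/∂x² − 2·∂²U₄/∂x²`. -/
theorem second_derivatives_of_first_component (D : Set (ℝ × ℝ)) (hD : IsOpen D)
    (U₁ U₂ U₃ U₄ W : ℝ × ℝ → ℝ)
    (h₁ : ContDiffOn ℝ 2 U₁ D) (h₂ : ContDiffOn ℝ 2 U₂ D)
    (h₃ : ContDiffOn ℝ 2 U₃ D) (h₄ : ContDiffOn ℝ 2 U₄ D)
    (hCR : ∀ p ∈ D, CRsys U₁ U₂ U₃ U₄ p)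
    (hW : W = U₁) :
    ∀ p ∈ D,
      pdx (pdx W) p = pdx (pdx U₁) p ∧
      pdy (pdy W) p = pdx (pdx U₁) p - 2 * pdx (pdx U₄) p := by
  subst hW
  intro p hp
  have hDp : D ∈ nhds p := hD.mem_nhds hp
  refine ⟨rfl, ?_⟩
  have hy₁ : pdy W =ᶠ[nhds p] pdx U₃ :=
    Filter.mem_of_superset hDp fun q hq => (hCR q hq).1
  have hy₃ : pdy U₃ =ᶠ[nhds p] fun q => pdx W q - 2 * pdx U₄ q :=
    Filter.mem_of_superset hDp fun q hq => (hCR q hq).2.2.1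
  have hd₁ := differentiableAt_pdx (h₁.contDiffAt hDp)
  have hd₄ := differentiableAt_pdx (h₄.contDiffAt hDp)
  rw [pdy_congr_of_eventuallyEq hy₁, pdy_pdx_comm (h₃.contDiffAt hDp),
    pdx_congr_of_eventuallyEq hy₃]
  have h := hd₁.hasFDerivAt.sub (hd₄.hasFDerivAt.const_mul 2)
  change fderiv ℝ (pdx W - fun q => 2 * pdx U₄ q) p (1, 0) = _
  rw [h.fderiv]
  simp [pdx]
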